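/- arXiv:1712.09220 — 2 statements merged into one kernel-verified Lean document; each statement's English description precedes it below -/
import Mathlib

section
/- Let x, y ∈ ℝ and let u ∈ (0,∞). Then 0 ≤ φ(y + x·z) − φ(y) − x·z·φ'(y) for every z > 0, and ∫₀^∞ { φ(y + x·z) − φ(y) − x·z·φ'(y) } ν(dz) ≤ 2·{ δ·|x|²/(ε·log δ)·∫₀^u z² ν(dz) + |x|·∫_u^∞ z ν(dz) }. -/
open MeasureTheory Filter Set

/-- The primitive vanishing at `0` of an even function is odd. -/
lemma intervalIntegral_zero_neg_of_even {f : ℝ → ℝ} (hf : ∀ x, f (-x) = f x) (y : ℝ) :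
    ∫ z in (0:ℝ)..(-y), f z = -∫ z in (0:ℝ)..y, f z := by
  have h := intervalIntegral.integral_comp_neg (a := 0) (b := y) f
  simp only [hf, neg_zero] at h
  rw [h, ← intervalIntegral.integral_symm]

/-- The primitive vanishing at `0` of an odd function is even. -/
lemma intervalIntegral_zero_neg_of_odd {f : ℝ → ℝ} (hf : ∀ x, f (-x) = -f x) (y : ℝ) :
    ∫ z in (0:ℝ)..(-y), f z = ∫ z in (0:ℝ)..y, f z := by
  have h := intervalIntegral.integral_comp_neg (a := 0) (b := y) f
  simp only [hf, neg_zero, intervalIntegral.integral_neg] at h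
  rw [intervalIntegral.integral_symm, ← h, neg_neg]

lemma integral_abs_integral_eq (ψ : ℝ → ℝ) (x : ℝ) :
    ∫ y in (0:ℝ)..|x|, ∫ z in (0:ℝ)..y, ψ z = ∫ y in (0:ℝ)..x, ∫ z in (0:ℝ)..y, ψ |z| := by
  have h1 : ∫ y in (0:ℝ)..|x|, ∫ z in (0:ℝ)..y, ψ z
      = ∫ y in (0:ℝ)..|x|, ∫ z in (0:ℝ)..y, ψ |z| := by
    refine intervalIntegral.integral_congr fun y hy => ?_
    rw [uIcc_of_le (abs_nonneg x)] at hy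
    refine intervalIntegral.integral_congr fun z hz => ?_
    rw [uIcc_of_le hy.1] at hz
    simp only [abs_of_nonneg hz.1]
  rw [h1]
  rcases abs_choice x with h | h
  · rw [h]
  · rw [h]
    exact intervalIntegral_zero_neg_of_odd
      (fun y => intervalIntegral_zero_neg_of_even (fun z => by rw [abs_neg]) y) x

lemma integral_le_integral_of_support_subset {f : ℝ → ℝ} (hc : Continuous f) (h0 : ∀ z, 0 ≤ f z)
    {a b : ℝ} (hab : a ≤ b) (hs : Function.support f ⊆ Icc a b) {c d : ℝ} (hcd : c ≤ d) :
    ∫ z in c..d, f z ≤ ∫ z in a..b, f z := by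
  have hint : Integrable f :=
    hc.integrable_of_hasCompactSupport
      (HasCompactSupport.of_support_subset_isCompact isCompact_Icc hs)
  rw [intervalIntegral.integral_of_le hcd, intervalIntegral.integral_of_le hab,
    ← integral_Icc_eq_integral_Ioc (x := a), setIntegral_eq_integral_of_forall_compl_eq_zero
      (s := Icc a b) (fun x hx => by_contra fun h => hx (hs h))]
  exact setIntegral_le_integral hint (Eventually.of_forall h0)

/-- Mean value bounds for the first-order Taylor remainder of a function with monotone,
Lipschitz and bounded derivative. -/
lemma taylor_remainder_bounds {f g : ℝ → ℝ} (hf : ∀ x, HasDerivAt f (g x) x) (hg : Monotone g)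
    {M B : ℝ} (hM : ∀ a b, |g b - g a| ≤ M * |b - a|) (hM0 : 0 ≤ M) (hB : ∀ a, |g a| ≤ B)
    (a h : ℝ) :
    0 ≤ f (a + h) - f a - h * g a ∧ f (a + h) - f a - h * g a ≤ M * h ^ 2 ∧
      f (a + h) - f a - h * g a ≤ 2 * B * |h| := by
  obtain ⟨c, hc, hca, hpos⟩ : ∃ c, f (a + h) - f a - h * g a = h * (g c - g a) ∧
      |c - a| ≤ |h| ∧ 0 ≤ h * (g c - g a) := by
    have hcont : Continuous f := continuous_iff_continuousAt.2 fun x => (hf x).continuousAt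
    rcases lt_trichotomy h 0 with hh | rfl | hh
    · obtain ⟨c, ⟨h1, h2⟩, h3⟩ := exists_hasDerivAt_eq_slope f g (show a + h < a by linarith)
        hcont.continuousOn fun x _ => hf x
      refine ⟨c, ?_, ?_, mul_nonneg_of_nonpos_of_nonpos hh.le (sub_nonpos.2 (hg h2.le))⟩
      · rw [h3]; field_simp [hh.ne]; ring
      · rw [abs_of_neg hh, abs_of_neg (by linarith)]; linarith
    · exact ⟨a, by simp⟩
    · obtain ⟨c, ⟨h1, h2⟩, h3⟩ := exists_hasDerivAt_eq_slope f g (show a < a + h by linarith)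
        hcont.continuousOn fun x _ => hf x
      refine ⟨c, ?_, ?_, mul_nonneg hh.le (sub_nonneg.2 (hg h1.le))⟩
      · rw [h3]; field_simp [hh.ne']; ring
      · rw [abs_of_pos hh, abs_of_pos (by linarith)]; linarith
  rw [hc]
  have habs : h * (g c - g a) ≤ |h| * |g c - g a| := (le_abs_self _).trans (abs_mul _ _).le
  refine ⟨hpos, ?_, ?_⟩
  · calc h * (g c - g a) ≤ |h| * |g c - g a| := habs
      _ ≤ |h| * (M * |h|) := by
        gcongr
        exact (hM a c).trans (by gcongr)
      _ = M * h ^ 2 := by rw [← sq_abs h]; ring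
  · calc h * (g c - g a) ≤ |h| * |g c - g a| := habs
      _ ≤ |h| * (B + B) := by
        gcongr
        exact (abs_sub _ _).trans (add_le_add (hB c) (hB a))
      _ = 2 * B * |h| := by ring

lemma integrableOn_min_self_sq {ν : Measure ℝ}
    (hν : (∫⁻ z in Ioi (0:ℝ), ENNReal.ofReal (min z (z ^ 2)) ∂ν) < ⊤) :
    IntegrableOn (fun z : ℝ => min z (z ^ 2)) (Ioi 0) ν := by
  refine ⟨by fun_prop, ?_⟩
  rw [hasFiniteIntegral_iff_ofReal]
  · exact hν
  · filter_upwards [ae_restrict_mem measurableSet_Ioi] with z hz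
    exact le_min (le_of_lt hz) (sq_nonneg z)

lemma integrableOn_sq_Ioc {ν : Measure ℝ}
    (hν : (∫⁻ z in Ioi (0:ℝ), ENNReal.ofReal (min z (z ^ 2)) ∂ν) < ⊤) (u : ℝ) :
    IntegrableOn (fun z : ℝ => z ^ 2) (Ioc 0 u) ν := by
  refine Integrable.mono' (((integrableOn_min_self_sq hν).mono_set Ioc_subset_Ioi_self).const_mul
    (max 1 u)) (by fun_prop) ?_
  filter_upwards [ae_restrict_mem measurableSet_Ioc] with z hz
  rw [Real.norm_of_nonneg (sq_nonneg z), mul_min_of_nonneg _ _ (by positivity)]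
  refine le_min ?_ ?_
  · nlinarith [hz.1, hz.2, le_max_right 1 u]
  · nlinarith [sq_nonneg z, le_max_left 1 u]

lemma integrableOn_id_Ioi {ν : Measure ℝ}
    (hν : (∫⁻ z in Ioi (0:ℝ), ENNReal.ofReal (min z (z ^ 2)) ∂ν) < ⊤) {u : ℝ} (hu : 0 < u) :
    IntegrableOn (fun z : ℝ => z) (Ioi u) ν := by
  refine Integrable.mono' (((integrableOn_min_self_sq hν).mono_set
    (Ioi_subset_Ioi hu.le)).const_mul (max 1 u⁻¹)) (by fun_prop) ?_
  filter_upwards [ae_restrict_mem measurableSet_Ioi] with z hz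
  have hz0 : 0 < z := hu.trans hz
  rw [Real.norm_of_nonneg hz0.le, mul_min_of_nonneg _ _ (by positivity)]
  refine le_min ?_ ?_
  · nlinarith [le_max_left 1 u⁻¹]
  · have h1 : 1 ≤ u⁻¹ * z := by
      rw [← inv_mul_cancel₀ hu.ne']
      exact mul_le_mul_of_nonneg_left (le_of_lt hz) (by positivity)
    have h2 : 1 ≤ max 1 u⁻¹ * z :=
      h1.trans (mul_le_mul_of_nonneg_right (le_max_right _ _) hz0.le)
    nlinarith

lemma lintegral_Ioi_le_of_sq_of_linear_bound {ν : Measure ℝ}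
    (hν : (∫⁻ z in Ioi (0:ℝ), ENNReal.ofReal (min z (z ^ 2)) ∂ν) < ⊤) {u : ℝ} (hu : 0 < u)
    {f : ℝ → ℝ} {A B : ℝ} (hA : 0 ≤ A) (hB : 0 ≤ B) (h1 : ∀ z > 0, f z ≤ A * z ^ 2)
    (h2 : ∀ z > 0, f z ≤ B * z) :
    ∫⁻ z in Ioi (0:ℝ), ENNReal.ofReal (f z) ∂ν ≤
      ENNReal.ofReal (A * (∫ z in Ioc (0:ℝ) u, z ^ 2 ∂ν) + B * ∫ z in Ioi u, z ∂ν) := by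
  have hI1 : 0 ≤ ∫ z in Ioc (0:ℝ) u, z ^ 2 ∂ν :=
    setIntegral_nonneg measurableSet_Ioc fun z _ => sq_nonneg z
  have hI2 : 0 ≤ ∫ z in Ioi u, z ∂ν :=
    setIntegral_nonneg measurableSet_Ioi fun z hz => (hu.trans hz).le
  rw [← Ioc_union_Ioi_eq_Ioi hu.le,
    lintegral_union measurableSet_Ioi (Ioc_disjoint_Ioi le_rfl),
    ENNReal.ofReal_add (by positivity) (by positivity), ← integral_const_mul,
    ← integral_const_mul,
    ofReal_integral_eq_lintegral_ofReal ((integrableOn_sq_Ioc hν u).const_mul A)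
      (Eventually.of_forall fun z => mul_nonneg hA (sq_nonneg z)),
    ofReal_integral_eq_lintegral_ofReal ((integrableOn_id_Ioi hν hu).const_mul B)
      (by
        filter_upwards [ae_restrict_mem measurableSet_Ioi] with z hz
        exact mul_nonneg hB (hu.trans hz).le)]
  refine add_le_add (setLIntegral_mono (by fun_prop) fun z hz => ?_)
    (setLIntegral_mono (by fun_prop) fun z hz => ?_)
  · exact ENNReal.ofReal_le_ofReal (h1 z hz.1)
  · exact ENNReal.ofReal_le_ofReal (h2 z (hu.trans hz))

theorem statement9 (δ ε : ℝ) (hδ : 1 < δ) (hε : ε ∈ Set.Ioo (0:ℝ) 1)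
    (ψ : ℝ → ℝ) (hψc : Continuous ψ) (hψ0 : ∀ z, 0 ≤ ψ z)
    (hψsupp : Function.support ψ ⊆ Set.Icc (ε / δ) ε)
    (hψint : (∫ z in (ε / δ)..ε, ψ z) = 1)
    (hψbd : ∀ z > 0, ψ z ≤ 2 / (z * Real.log δ))
    (φ φ' φ'' : ℝ → ℝ)
    (hφ : ∀ x, φ x = ∫ y in (0:ℝ)..|x|, ∫ z in (0:ℝ)..y, ψ z)
    (hD1 : ∀ x, HasDerivAt φ (φ' x) x)
    (hD2 : ∀ x, HasDerivAt φ' (φ'' x) x)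
    (hD2c : Continuous φ'')
    (ν : MeasureTheory.Measure ℝ) (hν0 : ν (Set.Iic (0:ℝ)) = 0)
    (hνfin : (∫⁻ z in Set.Ioi (0:ℝ), ENNReal.ofReal (min z (z^2)) ∂ν) < ⊤) :
    ∀ x y : ℝ, ∀ u > 0,
      (∀ z > 0, 0 ≤ φ (y + x * z) - φ y - x * z * φ' y) ∧
      (∫⁻ z in Set.Ioi (0:ℝ),
          ENNReal.ofReal (φ (y + x * z) - φ y - x * z * φ' y) ∂ν) ≤
        ENNReal.ofReal (2 *
          (δ * |x| ^ 2 / (ε * Real.log δ) * (∫ z in Set.Ioc (0:ℝ) u, z ^ 2 ∂ν)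
            + |x| * (∫ z in Set.Ioi u, z ∂ν))) := by
  obtain ⟨hε0, -⟩ := hε
  have hlog : 0 < Real.log δ := Real.log_pos hδ
  have hδ0 : 0 < δ := one_pos.trans hδ
  have hψabs : Continuous fun z => ψ |z| := hψc.comp continuous_abs
  have hint : ∀ a b, IntervalIntegrable (fun z => ψ |z|) volume a b :=
    fun a b => hψabs.intervalIntegrable a b
  have hG : ∀ x, φ' x = ∫ z in (0:ℝ)..x, ψ |z| := by
    intro x
    have hcont : Continuous fun y => ∫ z in (0:ℝ)..y, ψ |z| :=
      intervalIntegral.continuous_primitive hint 0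
    have h := hcont.integral_hasStrictDerivAt 0 x
    rw [← funext fun x => (hφ x).trans (integral_abs_integral_eq ψ x)] at h
    exact (hD1 x).unique h.hasDerivAt
  have hGsub : ∀ a b, φ' b - φ' a = ∫ z in a..b, ψ |z| := fun a b => by
    rw [hG, hG, intervalIntegral.integral_interval_sub_left (hint _ _) (hint _ _)]
  have hmono : Monotone φ' := fun a b hab => by
    rw [← sub_nonneg, hGsub]
    exact intervalIntegral.integral_nonneg hab fun z _ => hψ0 _
  have hψM : ∀ z, ψ z ≤ 2 * δ / (ε * Real.log δ) := by
    intro z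
    by_cases hz : z ∈ Function.support ψ
    · have hzl := (hψsupp hz).1
      have hz0 : 0 < z := lt_of_lt_of_le (by positivity) hzl
      calc ψ z ≤ 2 / (z * Real.log δ) := hψbd z hz0
        _ ≤ 2 / (ε / δ * Real.log δ) := by gcongr
        _ = 2 * δ / (ε * Real.log δ) := by field_simp
    · rw [Function.notMem_support.1 hz]
      positivity
  have hLip : ∀ a b, |φ' b - φ' a| ≤ 2 * δ / (ε * Real.log δ) * |b - a| := by
    intro a b
    rw [hGsub, ← Real.norm_eq_abs]
    refine intervalIntegral.norm_integral_le_of_norm_le_const fun z _ => ?_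
    rw [Real.norm_of_nonneg (hψ0 _)]
    exact hψM _
  have hle : ∀ a, 0 ≤ a → |φ' a| ≤ 1 := by
    intro a ha
    rw [hG, abs_of_nonneg (intervalIntegral.integral_nonneg ha fun z _ => hψ0 _), ← hψint]
    refine le_of_eq_of_le (intervalIntegral.integral_congr fun z hz => ?_)
      (integral_le_integral_of_support_subset hψc hψ0 (div_le_self hε0.le hδ.le) hψsupp ha)
    rw [uIcc_of_le ha] at hz
    simp only [abs_of_nonneg hz.1]
  have hbd : ∀ a, |φ' a| ≤ 1 := by
    intro a
    rcases le_total 0 a with ha | ha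
    · exact hle a ha
    · have h := hle (-a) (neg_nonneg.2 ha)
      rwa [hG, intervalIntegral_zero_neg_of_even (fun z => by rw [abs_neg]), abs_neg, ← hG] at h
  intro x y u hu
  have key := fun z =>
    taylor_remainder_bounds hD1 hmono hLip (by positivity) hbd y (x * z)
  refine ⟨fun z _ => (key z).1, ?_⟩
  refine (lintegral_Ioi_le_of_sq_of_linear_bound hνfin hu
    (A := 2 * δ / (ε * Real.log δ) * |x| ^ 2) (B := 2 * |x|) (by positivity) (by positivity)
    (fun z _ => ?_) (fun z hz => ?_)).trans_eq ?_
  · refine (key z).2.1.trans_eq ?_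
    rw [sq_abs]
    ring
  · refine (key z).2.2.trans_eq ?_
    rw [abs_mul, abs_of_pos hz]
    ring
  · congr 1
    ring
end

section
/- Suppose in addition that ∫₀^∞ z² ν(dz) < ∞. Then for all x, x', y ∈ ℝ, ∫₀^∞ | φ(y + x·z) − φ(y + x'·z) − (x − x')·z·φ'(y) | ν(dz) ≤ 2·δ·(|x − x'|² + |x'|·|x − x'|)/(ε·log δ)·∫₀^∞ z² ν(dz); in particular this integral is finite. -/
open MeasureTheory Filter Set

/-- A second derivative of the even function `x ↦ ∫ y in 0..|x|, ∫ z in 0..y, ψ z`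
agrees with `ψ |x|` away from the origin. -/
lemma second_deriv_eq_of_iterated_integral {ψ φ φ' φ'' : ℝ → ℝ} (hψc : Continuous ψ)
    (hφ : ∀ x, φ x = ∫ y in (0:ℝ)..|x|, ∫ z in (0:ℝ)..y, ψ z)
    (hD1 : ∀ x, HasDerivAt φ (φ' x) x) (hD2 : ∀ x, HasDerivAt φ' (φ'' x) x)
    {x : ℝ} (hx : x ≠ 0) : φ'' x = ψ |x| := by
  set Ψ : ℝ → ℝ := fun y => ∫ z in (0:ℝ)..y, ψ z with hΨ
  have dΨ : ∀ y, HasDerivAt Ψ (ψ y) y := fun y => (hψc.integral_hasStrictDerivAt 0 y).hasDerivAt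
  have hΨc : Continuous Ψ := continuous_iff_continuousAt.2 fun y => (dΨ y).continuousAt
  have dG : ∀ y, HasDerivAt (fun t => ∫ s in (0:ℝ)..t, Ψ s) (Ψ y) y :=
    fun y => (hΨc.integral_hasStrictDerivAt 0 y).hasDerivAt
  rcases lt_or_gt_of_ne hx with hneg | hpos
  · have h1 : ∀ t < 0, φ' t = -Ψ (-t) := fun t ht => by
      refine (hD1 t).unique ?_
      have h := (dG (-t)).comp t (hasDerivAt_neg t)
      rw [mul_neg_one] at h
      refine h.congr_of_eventuallyEq ?_
      filter_upwards [Iio_mem_nhds ht] with s hs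
      rw [hφ s, abs_of_neg hs]
      rfl
    rw [abs_of_neg hneg]
    refine (hD2 x).unique ?_
    have h := ((dΨ (-x)).comp x (hasDerivAt_neg x)).neg
    rw [mul_neg_one, neg_neg] at h
    refine h.congr_of_eventuallyEq ?_
    filter_upwards [Iio_mem_nhds hneg] with s hs
    exact h1 s hs
  · have h1 : ∀ t > 0, φ' t = Ψ t := fun t ht => by
      refine (hD1 t).unique ((dG t).congr_of_eventuallyEq ?_)
      filter_upwards [Ioi_mem_nhds ht] with s hs
      rw [hφ s, abs_of_pos hs]
    rw [abs_of_pos hpos]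
    refine (hD2 x).unique ((dΨ x).congr_of_eventuallyEq ?_)
    filter_upwards [Ioi_mem_nhds hpos] with s hs
    exact h1 s hs

lemma le_of_support_subset_of_le_div {δ ε : ℝ} (hδ : 1 < δ) (hε : 0 < ε) {ψ : ℝ → ℝ}
    (hψsupp : Function.support ψ ⊆ Set.Icc (ε / δ) ε)
    (hψbd : ∀ z > 0, ψ z ≤ 2 / (z * Real.log δ)) (z : ℝ) :
    ψ z ≤ 2 * δ / (ε * Real.log δ) := by
  have hlog : 0 < Real.log δ := Real.log_pos hδ
  have hδ0 : 0 < δ := by linarith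
  by_cases hz : ψ z = 0
  · rw [hz]
    positivity
  · have hz1 : ε / δ ≤ z := (hψsupp hz).1
    have hpos : 0 < ε / δ := by positivity
    calc ψ z ≤ 2 / (z * Real.log δ) := hψbd z (hpos.trans_le hz1)
      _ ≤ 2 / (ε / δ * Real.log δ) := by gcongr
      _ = 2 * δ / (ε * Real.log δ) := by field_simp

/-- Error bound for a first order increment when the derivative is Lipschitz. -/
lemma abs_sub_sub_mul_deriv_le {f f' : ℝ → ℝ} {M : ℝ} (hf : ∀ t, HasDerivAt f (f' t) t)
    (hf' : ∀ a b, |f' a - f' b| ≤ M * |a - b|) (hM : 0 ≤ M) (x x' y : ℝ) {z : ℝ} (hz : 0 ≤ z) :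
    |f (y + x * z) - f (y + x' * z) - (x - x') * z * f' y| ≤
      M * (|x - x'| ^ 2 + |x'| * |x - x'|) * z ^ 2 := by
  have hbound : ∀ t ∈ Set.uIcc (y + x' * z) (y + x * z),
      ‖f' t - f' y‖ ≤ M * ((|x - x'| + |x'|) * z) := fun t ht => by
    refine (hf' t y).trans (mul_le_mul_of_nonneg_left ?_ hM)
    have h1 : |t - (y + x' * z)| ≤ |x - x'| * z := by
      refine (Set.abs_sub_left_of_mem_uIcc ht).trans_eq ?_
      rw [show y + x * z - (y + x' * z) = (x - x') * z by ring, abs_mul, abs_of_nonneg hz]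
    calc |t - y| = |(t - (y + x' * z)) + x' * z| := by ring_nf
      _ ≤ |t - (y + x' * z)| + |x' * z| := abs_add_le _ _
      _ ≤ |x - x'| * z + |x'| * z := by
        rw [abs_mul x' z, abs_of_nonneg hz]
        gcongr
      _ = (|x - x'| + |x'|) * z := by ring
  have hg : ∀ t ∈ Set.uIcc (y + x' * z) (y + x * z),
      HasDerivWithinAt (fun s => f s - s * f' y) (f' t - f' y)
        (Set.uIcc (y + x' * z) (y + x * z)) t := fun t _ => by
    have h := (hf t).fun_sub ((hasDerivAt_id' t).mul_const (f' y))
    rw [one_mul] at h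
    exact h.hasDerivWithinAt
  have key := (convex_uIcc _ _).norm_image_sub_le_of_norm_hasDerivWithin_le hg hbound
    Set.left_mem_uIcc Set.right_mem_uIcc
  rw [Real.norm_eq_abs, Real.norm_eq_abs] at key
  calc _ = |f (y + x * z) - (y + x * z) * f' y - (f (y + x' * z) - (y + x' * z) * f' y)| := by
        ring_nf
    _ ≤ _ := key
    _ = M * ((|x - x'| + |x'|) * z) * (|x - x'| * z) := by
      rw [show y + x * z - (y + x' * z) = (x - x') * z by ring, abs_mul, abs_of_nonneg hz]
    _ = _ := by ring

/-- A function bounded by `C * z ^ 2` on `(0, ∞)` has integral at most `C` times the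
second moment. -/
lemma lintegral_ofReal_le_mul_sq {ν : Measure ℝ} {C : ℝ} (hC : 0 ≤ C) {f : ℝ → ℝ}
    (hf : ∀ z > 0, f z ≤ C * z ^ 2)
    (hν2 : (∫⁻ z in Set.Ioi (0:ℝ), ENNReal.ofReal (z ^ 2) ∂ν) < ⊤) :
    (∫⁻ z in Set.Ioi (0:ℝ), ENNReal.ofReal (f z) ∂ν) ≤
      ENNReal.ofReal (C * ∫ z in Set.Ioi (0:ℝ), z ^ 2 ∂ν) := by
  have hint : Integrable (fun z : ℝ => z ^ 2) (ν.restrict (Set.Ioi 0)) := by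
    refine ⟨(by fun_prop : Measurable fun z : ℝ => z ^ 2).aestronglyMeasurable, ?_⟩
    rwa [hasFiniteIntegral_iff_ofReal (ae_of_all _ fun z => sq_nonneg z)]
  rw [← integral_const_mul, ofReal_integral_eq_lintegral_ofReal (hint.const_mul C)
    (ae_of_all _ fun z => mul_nonneg hC (sq_nonneg z))]
  exact setLIntegral_mono' measurableSet_Ioi fun z hz => ENNReal.ofReal_le_ofReal (hf z hz)

theorem statement12 (δ ε : ℝ) (hδ : 1 < δ) (hε : ε ∈ Set.Ioo (0:ℝ) 1)
    (ψ : ℝ → ℝ) (hψc : Continuous ψ) (hψ0 : ∀ z, 0 ≤ ψ z)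
    (hψsupp : Function.support ψ ⊆ Set.Icc (ε / δ) ε)
    (hψint : (∫ z in (ε / δ)..ε, ψ z) = 1)
    (hψbd : ∀ z > 0, ψ z ≤ 2 / (z * Real.log δ))
    (φ φ' φ'' : ℝ → ℝ)
    (hφ : ∀ x, φ x = ∫ y in (0:ℝ)..|x|, ∫ z in (0:ℝ)..y, ψ z)
    (hD1 : ∀ x, HasDerivAt φ (φ' x) x)
    (hD2 : ∀ x, HasDerivAt φ' (φ'' x) x)
    (hD2c : Continuous φ'')
    (ν : MeasureTheory.Measure ℝ) (hν0 : ν (Set.Iic (0:ℝ)) = 0)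
    (hν2 : (∫⁻ z in Set.Ioi (0:ℝ), ENNReal.ofReal (z ^ 2) ∂ν) < ⊤) :
    ∀ x x' y : ℝ,
      (∫⁻ z in Set.Ioi (0:ℝ),
          ENNReal.ofReal (|φ (y + x * z) - φ (y + x' * z) - (x - x') * z * φ' y|) ∂ν) ≤
        ENNReal.ofReal (2 * δ * (|x - x'| ^ 2 + |x'| * |x - x'|) / (ε * Real.log δ) *
          (∫ z in Set.Ioi (0:ℝ), z ^ 2 ∂ν)) ∧
      (∫⁻ z in Set.Ioi (0:ℝ),
          ENNReal.ofReal (|φ (y + x * z) - φ (y + x' * z) - (x - x') * z * φ' y|) ∂ν) < ⊤ := by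
  intro x x' y
  have hlog : 0 < Real.log δ := Real.log_pos hδ
  have hε0 : 0 < ε := hε.1
  have hδ0 : 0 < δ := by linarith
  have hM : 0 ≤ 2 * δ / (ε * Real.log δ) := by positivity
  have hbd : ∀ t, ‖φ'' t‖ ≤ 2 * δ / (ε * Real.log δ) := by
    have hdense : Dense ({0}ᶜ : Set ℝ) := dense_compl_singleton 0
    refine fun t => hdense.induction (P := fun t => ‖φ'' t‖ ≤ 2 * δ / (ε * Real.log δ))
      (fun s hs => ?_) (isClosed_le hD2c.norm continuous_const) t
    rw [second_deriv_eq_of_iterated_integral hψc hφ hD1 hD2 hs, Real.norm_of_nonneg (hψ0 _)]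
    exact le_of_support_subset_of_le_div hδ hε0 hψsupp hψbd _
  have hlip : ∀ a b, |φ' a - φ' b| ≤ 2 * δ / (ε * Real.log δ) * |a - b| := fun a b =>
    convex_univ.norm_image_sub_le_of_norm_hasDerivWithin_le
      (fun t _ => (hD2 t).hasDerivWithinAt) (fun t _ => hbd t) (Set.mem_univ b) (Set.mem_univ a)
  have main := lintegral_ofReal_le_mul_sq
    (C := 2 * δ * (|x - x'| ^ 2 + |x'| * |x - x'|) / (ε * Real.log δ)) (by positivity)
    (fun z hz => (abs_sub_sub_mul_deriv_le hD1 hlip hM x x' y (le_of_lt hz)).trans_eq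
      (by ring)) hν2
  exact ⟨main, main.trans_lt ENNReal.ofReal_lt_top⟩
end
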